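/- Let A be an associative unital ℂ-algebra and let I, J, K be finite index types. Suppose given elements b_i (i ∈ I), a_j, a†_j (j ∈ J), c_k, c†_k (k ∈ K) of A (the fermionic modes) and elements u_i (i ∈ I), v_j, v̄_j (j ∈ J), w_k, w̄_k (k ∈ K) of A (the translations) such that: (CAR) {b_i, b_{i'}} = 2δ_{ii'}·1, {a_j, a†_{j'}} = δ_{jj'}·1, {c_k, c†_{k'}} = δ_{kk'}·1, and all other anticommutators among the fermionic modes vanish (in particular {a_j,a_{j'}} = {a†_j,a†_{j'}} = {c_k,c_{k'}} = {c†_k,c†_{k'}} = 0 and modes of different families anticommute); (translations) u_i² = 1, v_j·v̄_j = v̄_j·v_j = 1, w_k·w̄_k = w̄_k·w_k = 1, and all translation elements pairwise commute; (compatibility) every fermionic mode commutes with every translation element. Then the operator F := Σ_{i∈I} b_i·u_i + Σ_{j∈J} (a_j·v̄_j + a†_j·v_j) + Σ_{k∈K} (c_k·w̄_k + c†_k·w_k) satisfies F² = (|I| + |J| + |K|)·1. -/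

import Mathlib

/-- If a mode commutes with the translation attached to another mode and the translations
commute, then the anticommutator of the products is the product of the anticommutator of the
modes and the translations. -/
theorem anticommutator_mul_mul {A : Type*} [Ring A] {m m' t t' : A}
    (htt : Commute t t') (h : Commute m t') (h' : Commute m' t) :
    (m * t) * (m' * t') + (m' * t') * (m * t) = (m * m' + m' * m) * (t * t') := by
  rw [h'.symm.mul_mul_mul_comm, h.symm.mul_mul_mul_comm, htt.symm.eq, add_mul]

/-- The square of a sum of anticommuting involutions is the number of summands. -/
theorem sum_mul_sum_eq_card_of_anticommute {A : Type*} [Ring A] [Algebra ℂ A]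
    {S : Type*} [Fintype S] [DecidableEq S] (x : S → A)
    (hx : ∀ s s', x s * x s' + x s' * x s = if s = s' then (2 : A) else 0) :
    (∑ s, x s) * (∑ s, x s) = (Fintype.card S : A) := by
  have key : (∑ s, x s) * (∑ s, x s) + (∑ s, x s) * (∑ s, x s) =
      (Fintype.card S : A) + (Fintype.card S : A) := by
    conv_lhs =>
      rw [Finset.sum_mul_sum]
      arg 2
      rw [Finset.sum_comm]
    simp only [← Finset.sum_add_distrib, hx, Finset.sum_ite_eq, Finset.mem_univ, if_true,
      Finset.sum_const, Finset.card_univ, nsmul_eq_mul, mul_two]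
  rw [← two_smul ℂ, ← two_smul ℂ (Fintype.card S : A)] at key
  exact smul_right_injective A (two_ne_zero (α := ℂ)) key

/-- The combinations `p * t' + q * t` of annihilation and creation operators with mutually
inverse translations satisfy the Clifford relations. -/
theorem anticommutator_ladder {A : Type*} [Ring A] {J : Type*} [DecidableEq J]
    {p q t t' : J → A}
    (hpq : ∀ j k, p j * q k + q k * p j = if j = k then (1 : A) else 0)
    (hpp : ∀ j k, p j * p k + p k * p j = 0) (hqq : ∀ j k, q j * q k + q k * q j = 0)
    (ht : ∀ j, t j * t' j = 1) (ht' : ∀ j, t' j * t j = 1)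
    (htt : ∀ j k, Commute (t j) (t k)) (htt' : ∀ j k, Commute (t j) (t' k))
    (ht't' : ∀ j k, Commute (t' j) (t' k))
    (hpt : ∀ j k, Commute (p j) (t k)) (hpt' : ∀ j k, Commute (p j) (t' k))
    (hqt : ∀ j k, Commute (q j) (t k)) (hqt' : ∀ j k, Commute (q j) (t' k)) (j k : J) :
    (p j * t' j + q j * t j) * (p k * t' k + q k * t k) +
      (p k * t' k + q k * t k) * (p j * t' j + q j * t j) = if j = k then (2 : A) else 0 := by
  have h₁ := anticommutator_mul_mul (ht't' j k) (hpt' j k) (hpt' k j)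
  have h₂ := anticommutator_mul_mul (htt' k j).symm (hpt j k) (hqt' k j)
  have h₃ := anticommutator_mul_mul (htt' j k) (hqt' j k) (hpt k j)
  have h₄ := anticommutator_mul_mul (htt j k) (hqt j k) (hqt k j)
  rw [hpp, zero_mul] at h₁
  rw [hpq] at h₂
  rw [add_comm (q j * p k), hpq] at h₃
  rw [hqq, zero_mul] at h₄
  have expand : ∀ x y z w : A, (x + y) * (z + w) + (z + w) * (x + y) =
      (x * z + z * x) + (x * w + w * x) + (y * z + z * y) + (y * w + w * y) := by
    intros; noncomm_ring
  rw [expand, h₁, h₂, h₃, h₄]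
  obtain rfl | hjk := eq_or_ne j k
  · simp [ht, ht', one_add_one_eq_two]
  · simp [hjk, hjk.symm]


/-- The operator `F` built out of fermionic modes (satisfying the CAR) multiplied by
commuting translation operators squares to the number of generators:
`F² = (|I| + |J| + |K|)·1`. -/
theorem fermionic_F_sq {A : Type*} [Ring A] [Algebra ℂ A]
    {I J K : Type*} [Fintype I] [Fintype J] [Fintype K]
    [DecidableEq I] [DecidableEq J] [DecidableEq K]
    (b : I → A) (a adag : J → A) (c cdag : K → A)
    (u : I → A) (v vbar : J → A) (w wbar : K → A)
    -- the nonvanishing canonical anticommutation relations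
    (hbb : ∀ i i', b i * b i' + b i' * b i = if i = i' then (2 : A) else 0)
    (haad : ∀ j j', a j * adag j' + adag j' * a j = if j = j' then (1 : A) else 0)
    (hccd : ∀ k k', c k * cdag k' + cdag k' * c k = if k = k' then (1 : A) else 0)
    -- all other anticommutators among the fermionic modes vanish
    (haa : ∀ j j', a j * a j' + a j' * a j = 0)
    (hadad : ∀ j j', adag j * adag j' + adag j' * adag j = 0)
    (hcc : ∀ k k', c k * c k' + c k' * c k = 0)
    (hcdcd : ∀ k k', cdag k * cdag k' + cdag k' * cdag k = 0)
    (hba : ∀ i j, b i * a j + a j * b i = 0)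
    (hbad : ∀ i j, b i * adag j + adag j * b i = 0)
    (hbc : ∀ i k, b i * c k + c k * b i = 0)
    (hbcd : ∀ i k, b i * cdag k + cdag k * b i = 0)
    (hac : ∀ j k, a j * c k + c k * a j = 0)
    (hacd : ∀ j k, a j * cdag k + cdag k * a j = 0)
    (hadc : ∀ j k, adag j * c k + c k * adag j = 0)
    (hadcd : ∀ j k, adag j * cdag k + cdag k * adag j = 0)
    -- translation relations
    (hu : ∀ i, u i * u i = 1)
    (hv : ∀ j, v j * vbar j = 1) (hv' : ∀ j, vbar j * v j = 1)
    (hw : ∀ k, w k * wbar k = 1) (hw' : ∀ k, wbar k * w k = 1)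
    -- all translation elements pairwise commute
    (htrans : ∀ x ∈ Set.range u ∪ Set.range v ∪ Set.range vbar ∪
        Set.range w ∪ Set.range wbar,
      ∀ y ∈ Set.range u ∪ Set.range v ∪ Set.range vbar ∪
        Set.range w ∪ Set.range wbar, Commute x y)
    -- every fermionic mode commutes with every translation element
    (hcompat : ∀ m ∈ Set.range b ∪ Set.range a ∪ Set.range adag ∪
        Set.range c ∪ Set.range cdag,
      ∀ t ∈ Set.range u ∪ Set.range v ∪ Set.range vbar ∪
        Set.range w ∪ Set.range wbar, Commute m t) :
    let F : A := (∑ i, b i * u i) + (∑ j, (a j * vbar j + adag j * v j)) +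
      (∑ k, (c k * wbar k + cdag k * w k))
    F * F = ((Fintype.card I + Fintype.card J + Fintype.card K : ℕ) : A) := by
  intro F
  simp only [Set.mem_union, or_imp, forall_and, Set.forall_mem_range] at htrans hcompat
  obtain ⟨⟨⟨⟨⟨⟨⟨⟨h_u_u, _⟩, _⟩, _⟩, _⟩,
    ⟨⟨⟨⟨h_u_v, h_v_v⟩, _⟩, _⟩, _⟩⟩,
    ⟨⟨⟨⟨h_u_v', h_v_v'⟩, h_v'_v'⟩, _⟩, _⟩⟩,
    ⟨⟨⟨⟨h_u_w, h_v_w⟩, h_v'_w⟩, h_w_w⟩, _⟩⟩,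
    ⟨⟨⟨⟨h_u_w', h_v_w'⟩, h_v'_w'⟩, h_w_w'⟩, h_w'_w'⟩⟩ := htrans
  obtain ⟨⟨⟨⟨⟨⟨⟨⟨h_b_u, h_a_u⟩, h_a'_u⟩, h_c_u⟩, h_c'_u⟩,
    ⟨⟨⟨⟨h_b_v, h_a_v⟩, h_a'_v⟩, h_c_v⟩, h_c'_v⟩⟩,
    ⟨⟨⟨⟨h_b_v', h_a_v'⟩, h_a'_v'⟩, h_c_v'⟩, h_c'_v'⟩⟩,
    ⟨⟨⟨⟨h_b_w, h_a_w⟩, h_a'_w⟩, h_c_w⟩, h_c'_w⟩⟩,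
    ⟨⟨⟨⟨h_b_w', h_a_w'⟩, h_a'_w'⟩, h_c_w'⟩, h_c'_w'⟩⟩ := hcompat
  have anti_zero : ∀ {m m' t t' : A}, m * m' + m' * m = 0 → Commute t t' → Commute m t' →
      Commute m' t → (m * t) * (m' * t') + (m' * t') * (m * t) = 0 := by
    intro m m' t t' hm htt h h'
    rw [anticommutator_mul_mul htt h h', hm, zero_mul]
  have anti_add : ∀ {x y z : A}, x * y + y * x = 0 → x * z + z * x = 0 →
      x * (y + z) + (y + z) * x = 0 := by
    intro x y z hy hz
    rw [mul_add, add_mul, add_add_add_comm, hy, hz, add_zero]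
  have anti_symm : ∀ {x y : A}, x * y + y * x = 0 → y * x + x * y = 0 := by
    intro x y h
    rw [add_comm, h]
  let p : J → A := fun j => a j * vbar j + adag j * v j
  let q : K → A := fun k => c k * wbar k + cdag k * w k
  have hII : ∀ i i', (b i * u i) * (b i' * u i') + (b i' * u i') * (b i * u i) =
      if i = i' then (2 : A) else 0 := by
    intro i i'
    rw [anticommutator_mul_mul (h_u_u i i') (h_b_u i i') (h_b_u i' i), hbb]
    obtain rfl | hne := eq_or_ne i i'
    · simp [hu]
    · simp [hne]
  have hJJ : ∀ j j', p j * p j' + p j' * p j = if j = j' then (2 : A) else 0 :=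
    anticommutator_ladder haad haa hadad hv hv' h_v_v h_v_v' h_v'_v' h_a_v h_a_v' h_a'_v h_a'_v'
  have hKK : ∀ k k', q k * q k' + q k' * q k = if k = k' then (2 : A) else 0 :=
    anticommutator_ladder hccd hcc hcdcd hw hw' h_w_w h_w_w' h_w'_w' h_c_w h_c_w' h_c'_w h_c'_w'
  have hIJ : ∀ i j, (b i * u i) * p j + p j * (b i * u i) = 0 := fun i j =>
    anti_add (anti_zero (hba i j) (h_u_v' i j) (h_b_v' i j) (h_a_u j i))
      (anti_zero (hbad i j) (h_u_v i j) (h_b_v i j) (h_a'_u j i))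
  have hIK : ∀ i k, (b i * u i) * q k + q k * (b i * u i) = 0 := fun i k =>
    anti_add (anti_zero (hbc i k) (h_u_w' i k) (h_b_w' i k) (h_c_u k i))
      (anti_zero (hbcd i k) (h_u_w i k) (h_b_w i k) (h_c'_u k i))
  have hJK : ∀ j k, p j * q k + q k * p j = 0 := fun j k =>
    anti_add
      (anti_symm (anti_add
        (anti_symm (anti_zero (hac j k) (h_v'_w' j k) (h_a_w' j k) (h_c_v' k j)))
        (anti_symm (anti_zero (hadc j k) (h_v_w' j k) (h_a'_w' j k) (h_c_v k j)))))
      (anti_symm (anti_add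
        (anti_symm (anti_zero (hacd j k) (h_v'_w j k) (h_a_w j k) (h_c'_v' k j)))
        (anti_symm (anti_zero (hadcd j k) (h_v_w j k) (h_a'_w j k) (h_c'_v k j)))))
  have hsq := sum_mul_sum_eq_card_of_anticommute
    (Sum.elim (Sum.elim (fun i => b i * u i) p) q) (by
      rintro ((i | j) | k) ((i' | j') | k')
      · simpa using hII i i'
      · simpa using hIJ i j'
      · simpa using hIK i k'
      · simpa using anti_symm (hIJ i' j)
      · simpa using hJJ j j'
      · simpa using hJK j k'
      · simpa using anti_symm (hIK i' k)
      · simpa using anti_symm (hJK j' k)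
      · simpa using hKK k k')
  simpa only [Fintype.sum_sum_type, Sum.elim_inl, Sum.elim_inr, Fintype.card_sum] using hsq
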